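/- Let G be a finite group, p an odd prime dividing the order of G, and H ≤ G a Sylow p-subgroup. If V is a finite-dimensional real representation of G of odd dimension, then V^H ≠ 0, i.e. there is a nonzero vector of V fixed by every element of H. -/

import Mathlib

open Module

/-- A monic real polynomial of odd degree has a real root. -/
theorem Polynomial.Monic.exists_isRoot_of_odd_natDegree {f : Polynomial ℝ} (hf : f.Monic)
    (hodd : Odd f.natDegree) : ∃ x, f.IsRoot x := by
  by_contra! h
  have hlc : 0 ≤ f.leadingCoeff := by simp [hf.leadingCoeff]
  have h₁ : 0 < f.eval 0 :=
    zero_lt_eval_of_roots_lt_of_leadingCoeff_nonneg (fun y hy ↦ absurd hy (h y)) hlc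
  have h₂ := zero_lt_negOnePow_mul_eval_of_lt_roots_of_leadingCoeff_nonneg (x := 0)
    (fun y hy ↦ absurd hy (h y)) hlc
  rw [Int.negOnePow_odd _ (by exact_mod_cast hodd)] at h₂
  push_cast at h₂
  linarith

/-- An endomorphism of an odd-dimensional real vector space has a real eigenvalue. -/
theorem Module.End.exists_hasEigenvalue_of_odd_finrank {V : Type*} [AddCommGroup V] [Module ℝ V]
    [FiniteDimensional ℝ V] (f : End ℝ V) (hodd : Odd (finrank ℝ V)) :
    ∃ μ, f.HasEigenvalue μ := by
  obtain ⟨μ, hμ⟩ := (LinearMap.charpoly_monic f).exists_isRoot_of_odd_natDegree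
    (by rwa [LinearMap.charpoly_natDegree])
  exact ⟨μ, (hasEigenvalue_iff_isRoot_charpoly f μ).2 hμ⟩

/-- The fixed space of an endomorphism of odd order on an odd-dimensional real vector space
has odd dimension. -/
theorem Module.End.odd_finrank_ker_sub_one {V : Type*} [AddCommGroup V] [Module ℝ V]
    [FiniteDimensional ℝ V] {f : End ℝ V} {n : ℕ} (hn : Odd n) (hf : f ^ n = 1)
    (hodd : Odd (finrank ℝ V)) : Odd (finrank ℝ (LinearMap.ker (f - 1))) := by
  by_contra hker
  have hrange : Odd (finrank ℝ (LinearMap.range (f - 1))) := by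
    have := LinearMap.finrank_range_add_finrank_ker (f - 1)
    grind
  have hmaps : ∀ w ∈ LinearMap.range (f - 1), f w ∈ LinearMap.range (f - 1) := by
    rintro _ ⟨u, rfl⟩
    exact ⟨f u, by simp⟩
  obtain ⟨μ, hμ⟩ := exists_hasEigenvalue_of_odd_finrank (f.restrict hmaps) hrange
  obtain ⟨⟨w, u, rfl⟩, hw⟩ := hμ.exists_hasEigenvector
  set w := (f - 1) u
  have hw0 : w ≠ 0 := fun h ↦ hw.2 (Subtype.ext h)
  have hfw : f w = μ • w := congrArg Subtype.val hw.apply_eq_smul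
  have hpow (k : ℕ) : (f ^ k) w = μ ^ k • w := by
    induction k with
    | zero => simp
    | succ k ih => rw [pow_succ', Module.End.mul_apply, ih, map_smul, hfw, smul_smul, pow_succ]
  have hμn : μ ^ n = 1 := by
    have h := hpow n
    rw [hf, Module.End.one_apply] at h
    exact smul_left_injective ℝ hw0 (by simpa using h.symm)
  have hμ1 : μ = 1 := hn.strictMono_pow.injective (by simpa using hμn)
  have hsum : (∑ i ∈ Finset.range n, f ^ i) w = 0 := by
    rw [← Module.End.mul_apply, geom_sum_mul, hf, sub_self, LinearMap.zero_apply]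
  simp only [LinearMap.sum_apply, hpow, hμ1, one_pow, one_smul, Finset.sum_const,
    Finset.card_range, ← Nat.cast_smul_eq_nsmul ℝ n, smul_eq_zero, hw0, or_false,
    Nat.cast_eq_zero] at hsum
  exact hn.pos.ne' hsum

/-- If a finite `p`-group acts nontrivially on `V`, some element acts as a nontrivial
endomorphism commuting with the whole action. -/
theorem IsPGroup.exists_ne_one_forall_commute {k G V : Type*} [CommSemiring k] [AddCommMonoid V]
    [Module k V] [Group G] [Finite G] {p : ℕ} [Fact p.Prime] (hG : IsPGroup p G)
    (ρ : Representation k G V) (hρ : ∃ g, ρ g ≠ 1) :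
    ∃ z, ρ z ≠ 1 ∧ ∀ g, Commute (ρ z) (ρ g) := by
  let φ := MonoidHom.toHomUnits ρ
  obtain ⟨g, hg⟩ := hρ
  have hφ : Nontrivial φ.range :=
    ⟨⟨φ.rangeRestrict g, 1, fun h ↦ hg (congrArg Units.val (congrArg Subtype.val h))⟩⟩
  have : Finite φ.range := .of_surjective _ φ.rangeRestrict_surjective
  have := (hG.of_surjective _ φ.rangeRestrict_surjective).center_nontrivial
  obtain ⟨⟨⟨_, z, rfl⟩, hz⟩, hz1⟩ := exists_ne (1 : Subgroup.center φ.range)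
  refine ⟨z, fun h ↦ hz1 (Subtype.ext (Subtype.ext (Units.ext h))), fun g ↦ ?_⟩
  exact congrArg Units.val
    (congrArg Subtype.val (Subgroup.mem_center_iff.1 hz (φ.rangeRestrict g)).symm)

/-- A finite `p`-group, `p` odd, acting on an odd-dimensional real vector space fixes a
nonzero vector. -/
theorem IsPGroup.exists_ne_zero_forall_apply_eq {G V : Type*} [Group G] [Finite G] {p : ℕ}
    [Fact p.Prime] (hp : Odd p) (hG : IsPGroup p G) [AddCommGroup V] [Module ℝ V]
    [FiniteDimensional ℝ V] (ρ : Representation ℝ G V) (hodd : Odd (finrank ℝ V)) :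
    ∃ v : V, v ≠ 0 ∧ ∀ g, ρ g v = v := by
  induction hd : finrank ℝ V using Nat.strong_induction_on generalizing V with
  | _ d ih =>
  by_cases hρ : ∃ g, ρ g ≠ 1
  · obtain ⟨z, hz1, hz⟩ := hG.exists_ne_one_forall_commute ρ hρ
    obtain ⟨n, hn⟩ := hG z
    have hW := End.odd_finrank_ker_sub_one (f := ρ z) (hp.pow (n := n))
      (by rw [← map_pow, hn, map_one]) hodd
    have hlt : finrank ℝ (LinearMap.ker (ρ z - 1)) < d := by
      rw [← hd]
      refine Submodule.finrank_lt fun h ↦ hz1 ?_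
      rwa [LinearMap.ker_eq_top, sub_eq_zero] at h
    have hmaps (g : G) : LinearMap.ker (ρ z - 1) ≤ (LinearMap.ker (ρ z - 1)).comap (ρ g) := by
      intro v hv
      have hv' : ρ z v = v := by simpa [sub_eq_zero] using hv
      have hcomm : ρ z (ρ g v) = ρ g (ρ z v) := LinearMap.congr_fun (hz g) v
      simp [hcomm, hv']
    obtain ⟨v, hv0, hv⟩ := ih _ hlt (ρ.subrepresentation _ hmaps) hW rfl
    exact ⟨v, fun h ↦ hv0 (Subtype.ext h), fun g ↦ congrArg Subtype.val (hv g)⟩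
  · push Not at hρ
    have : Nontrivial V := nontrivial_of_finrank_pos (R := ℝ) hodd.pos
    obtain ⟨v, hv⟩ := exists_ne (0 : V)
    exact ⟨v, hv, fun g ↦ by simp [hρ g]⟩

/-- Let `G` be a finite group, `p` an odd prime dividing the order of `G`, and
`P` a Sylow `p`-subgroup of `G`. If `V` is a finite-dimensional real representation
of `G` of odd dimension, then there is a nonzero vector of `V` fixed by every
element of `P`, i.e. `V^P ≠ 0`. -/
theorem stmt1 (G V : Type*) [Group G] [Fintype G]
    (p : ℕ) [Fact p.Prime] (hp_odd : p ≠ 2) (hdvd : p ∣ Fintype.card G)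
    (P : Sylow p G)
    [AddCommGroup V] [Module ℝ V] [FiniteDimensional ℝ V]
    [DistribMulAction G V] [SMulCommClass G ℝ V]
    (hodd : Odd (Module.finrank ℝ V)) :
    ∃ v : V, v ≠ 0 ∧ ∀ h ∈ (P : Subgroup G), h • v = v := by
  obtain ⟨v, hv0, hv⟩ := P.isPGroup'.exists_ne_zero_forall_apply_eq
    ((Fact.out : p.Prime).odd_of_ne_two hp_odd)
    ((Representation.ofDistribMulAction ℝ G V).comp (P : Subgroup G).subtype) hodd
  exact ⟨v, hv0, fun h hh ↦ hv ⟨h, hh⟩⟩
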